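/- Let Ω ⊂ ℝ² be open and bounded, T > 0, and let u, v : Ω × [0,T] → ℝ be C² in space and C¹ in time on Ω × (0,T), with u continuous on the closure of Ω × [0,T] and v continuous on Ω × [0,T], both solving ∂u/∂t = e^{-2u}·Δu. Suppose there exists a continuous V : Ω → ℝ with V(x) → ∞ as x → ∂Ω such that v(x,t) ≥ V(x) for all x ∈ Ω and t ∈ [0,T]. If v(·,0) ≥ u(·,0) on Ω, then v ≥ u on Ω × [0,T]. -/

import Mathlib

/-- The Euclidean Laplacian of a function on `ℝ × ℝ`, expressed via iterated partial
derivatives in each coordinate. -/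
noncomputable def lap2 (f : ℝ × ℝ → ℝ) (p : ℝ × ℝ) : ℝ :=
  deriv (fun x => deriv (fun x' => f (x', p.2)) x) p.1 +
  deriv (fun y => deriv (fun y' => f (p.1, y')) y) p.2

lemma dcp_second_nonneg (h : ℝ → ℝ) (x : ℝ) (hc : ContinuousAt h x) (hm : IsLocalMin h x) :
    0 ≤ deriv (deriv h) x := by
  by_contra hlt
  push Not at hlt
  have h0 : deriv h x = 0 := hm.deriv_eq_zero
  have hM : IsLocalMax h x := isLocalMax_of_deriv_deriv_neg hlt h0 hc
  have he : h =ᶠ[nhds x] fun _ => h x := by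
    filter_upwards [hm, hM] with y h1 h2
    exact le_antisymm h2 h1
  have := he.deriv.deriv_eq
  simp at this
  linarith

lemma dcp_slice (f g : ℝ → ℝ) (x : ℝ) (hf : ContDiffAt ℝ 2 f x) (hg : ContDiffAt ℝ 2 g x)
    (hm : IsLocalMin (fun y => f y - g y) x) :
    deriv (fun y => deriv g y) x ≤ deriv (fun y => deriv f y) x := by
  have h1 := dcp_second_nonneg (fun y => f y - g y) x (hf.continuousAt.sub hg.continuousAt) hm
  have key : ∀ k : ℝ → ℝ, ContDiffAt ℝ 2 k x →
      (∀ᶠ y in nhds x, DifferentiableAt ℝ k y) ∧ DifferentiableAt ℝ (deriv k) x := by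
    intro k hk
    constructor
    · filter_upwards [hk.eventually (by simp)] with y hy
      exact hy.differentiableAt (by simp)
    · have : ContDiffAt ℝ 1 (deriv k) x := hk.derivWithin (by norm_num)
      exact this.differentiableAt (by simp)
  obtain ⟨f1, f2⟩ := key f hf
  obtain ⟨g1, g2⟩ := key g hg
  have he : deriv (fun y => f y - g y) =ᶠ[nhds x] fun y => deriv f y - deriv g y := by
    filter_upwards [f1, g1] with y a b
    exact deriv_fun_sub a b
  rw [he.deriv_eq, deriv_fun_sub f2 g2] at h1
  linarith

lemma dcp_lap (Ω : Set (ℝ × ℝ)) (hΩ : IsOpen Ω) (f g : ℝ × ℝ → ℝ) (p : ℝ × ℝ) (hp : p ∈ Ω)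
    (hf : ContDiffOn ℝ 2 f Ω) (hg : ContDiffOn ℝ 2 g Ω)
    (hm : ∀ q ∈ Ω, f p - g p ≤ f q - g q) : lap2 g p ≤ lap2 f p := by
  have hn := hΩ.mem_nhds hp
  have hf' := hf.contDiffAt hn
  have hg' := hg.contDiffAt hn
  have c1 : ContDiffAt ℝ 2 (fun x : ℝ => (x, p.2)) p.1 := by fun_prop
  have c2 : ContDiffAt ℝ 2 (fun x : ℝ => (p.1, x)) p.2 := by fun_prop
  unfold lap2
  apply add_le_add
  · apply dcp_slice (fun x => f (x, p.2)) (fun x => g (x, p.2))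
    · exact ContDiffAt.comp (g := f) p.1 hf' c1
    · exact ContDiffAt.comp (g := g) p.1 hg' c1
    · have : ∀ᶠ x in nhds p.1, (x, p.2) ∈ Ω := c1.continuousAt.eventually_mem hn
      filter_upwards [this] with x hx
      exact hm _ hx
  · apply dcp_slice (fun x => f (p.1, x)) (fun x => g (p.1, x))
    · exact ContDiffAt.comp (g := f) p.2 hf' c2
    · exact ContDiffAt.comp (g := g) p.2 hg' c2
    · have : ∀ᶠ x in nhds p.2, (p.1, x) ∈ Ω := c2.continuousAt.eventually_mem hn
      filter_upwards [this] with x hx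
      exact hm _ hx

/-- Existence of a first touching point. -/
lemma dcp_touch (Ω : Set (ℝ × ℝ)) (hΩopen : IsOpen Ω) (hΩbdd : Bornology.IsBounded Ω)
    (a : ℝ) (w : ℝ × ℝ → ℝ → ℝ)
    (hw : ContinuousOn (fun q : (ℝ × ℝ) × ℝ => w q.1 q.2) (Ω ×ˢ Set.Icc 0 a))
    (V : ℝ × ℝ → ℝ) (M : ℝ)
    (hV_blowup : ∀ x ∈ frontier Ω, Filter.Tendsto V (nhdsWithin x Ω) Filter.atTop)
    (hwV : ∀ t ∈ Set.Icc (0:ℝ) a, ∀ p ∈ Ω, V p - M ≤ w p t)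
    (h0 : ∀ p ∈ Ω, 0 < w p 0)
    (hstep : ∀ p ∈ Ω, ∀ t ∈ Set.Ioc (0:ℝ) a, w p t = 0 → (∀ q ∈ Ω, 0 ≤ w q t) →
      (∀ r ∈ Set.Ico 0 t, 0 < w p r) → False) :
    ∀ p ∈ Ω, ∀ t ∈ Set.Icc (0:ℝ) a, 0 < w p t := by
  by_contra hcon
  push Not at hcon
  obtain ⟨p1, hp1, t1, ht1, hle⟩ := hcon
  let A : Set ((ℝ × ℝ) × ℝ) := {q | q ∈ Ω ×ˢ Set.Icc 0 a ∧ w q.1 q.2 ≤ 0}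
  have hAclosed : IsClosed A := by
    apply isClosed_of_closure_subset
    intro q hq
    obtain ⟨z, hz, hlim⟩ := mem_closure_iff_seq_limit.1 hq
    have l1 : Filter.Tendsto (fun n => (z n).1) Filter.atTop (nhds q.1) :=
      (continuous_fst.tendsto q).comp hlim
    have l2 : Filter.Tendsto (fun n => (z n).2) Filter.atTop (nhds q.2) :=
      (continuous_snd.tendsto q).comp hlim
    have ht : q.2 ∈ Set.Icc 0 a :=
      isClosed_Icc.mem_of_tendsto l2 (Filter.Eventually.of_forall fun n => (hz n).1.2)
    have hcl : q.1 ∈ closure Ω :=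
      mem_closure_of_tendsto l1 (Filter.Eventually.of_forall fun n => (hz n).1.1)
    have hin : q.1 ∈ Ω := by
      by_contra hnot
      have hfr : q.1 ∈ frontier Ω := by
        rw [hΩopen.frontier_eq]; exact ⟨hcl, hnot⟩
      have l3 : Filter.Tendsto (fun n => (z n).1) Filter.atTop (nhdsWithin q.1 Ω) :=
        tendsto_nhdsWithin_iff.2 ⟨l1, Filter.Eventually.of_forall fun n => (hz n).1.1⟩
      have l4 := (hV_blowup _ hfr).comp l3
      obtain ⟨n, hn⟩ := (l4.eventually_gt_atTop M).exists
      have := hwV _ (hz n).1.2 _ (hz n).1.1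
      have := (hz n).2
      simp only [Function.comp] at hn
      linarith
    refine ⟨⟨hin, ht⟩, ?_⟩
    have l5 : Filter.Tendsto z Filter.atTop (nhdsWithin q (Ω ×ˢ Set.Icc 0 a)) :=
      tendsto_nhdsWithin_iff.2 ⟨hlim, Filter.Eventually.of_forall fun n => (hz n).1⟩
    have l6 := (hw q ⟨hin, ht⟩).tendsto.comp l5
    exact le_of_tendsto l6 (Filter.Eventually.of_forall fun n => (hz n).2)
  have hAcomp : IsCompact A := by
    apply Metric.isCompact_of_isClosed_isBounded hAclosed
    exact (hΩbdd.prod (Metric.isBounded_Icc 0 a)).subset fun q hq => hq.1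
  obtain ⟨⟨p, t⟩, ⟨⟨hp, ht⟩, hwle⟩, hmin⟩ :=
    hAcomp.exists_isMinOn ⟨(p1, t1), ⟨hp1, ht1⟩, hle⟩ continuous_snd.continuousOn
  simp only at hp ht hwle
  have hpos : ∀ q ∈ Ω, ∀ r ∈ Set.Ico 0 t, 0 < w q r := by
    intro q hq r hr
    by_contra hneg
    push Not at hneg
    have : t ≤ r := hmin (show (q, r) ∈ A from ⟨⟨hq, hr.1, hr.2.le.trans ht.2⟩, hneg⟩)
    exact absurd hr.2 (not_lt.2 this)
  have ht0 : 0 < t := by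
    rcases ht.1.lt_or_eq with h | h
    · exact h
    · subst h
      exact absurd (h0 p hp) (not_lt.2 hwle)
  have hnn : ∀ q ∈ Ω, 0 ≤ w q t := by
    intro q hq
    have hne : (nhdsWithin t (Set.Ico 0 t)).NeBot := by
      rw [nhdsWithin_Ico_eq_nhdsLT ht0]; infer_instance
    have l : Filter.Tendsto (fun r => (q, r)) (nhdsWithin t (Set.Ico 0 t))
        (nhdsWithin (q, t) (Ω ×ˢ Set.Icc 0 a)) := by
      refine tendsto_nhdsWithin_iff.2 ⟨?_, ?_⟩
      · exact (Continuous.tendsto (by fun_prop) t).mono_left nhdsWithin_le_nhds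
      · filter_upwards [self_mem_nhdsWithin] with r hr
        exact ⟨hq, hr.1, hr.2.le.trans ht.2⟩
    refine ge_of_tendsto ((hw (q, t) ⟨hq, ht⟩).tendsto.comp l) ?_
    filter_upwards [self_mem_nhdsWithin] with r hr
    exact (hpos q hq r hr).le
  exact hstep p hp t ⟨ht0, ht.2⟩ (le_antisymm hwle (hnn p hp)) hnn (hpos p hp)

lemma dcp_deriv_nonpos (h : ℝ → ℝ) (t d : ℝ) (ht : 0 < t) (hd : HasDerivAt h d t)
    (h0 : h t = 0) (hpos : ∀ r ∈ Set.Ico 0 t, 0 < h r) : d ≤ 0 := by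
  have h1 := (hasDerivWithinAt_iff_tendsto_slope' (s := Set.Iio t) (by simp)).1
    (hd.hasDerivWithinAt (s := Set.Iio t))
  refine le_of_tendsto h1 ?_
  filter_upwards [Ico_mem_nhdsLT ht] with r hr
  rw [slope_def_field, h0]
  exact div_nonpos_of_nonneg_of_nonpos (by linarith [hpos r hr]) (by linarith [hr.2])

/-- Direct comparison principle (Lemma B.1): let `Ω ⊂ ℝ²` be open and bounded,
`T > 0`, and `u, v` solutions of `∂w/∂t = e^{-2w}·Δw` on `Ω × (0,T)` which are C² in
space and C¹ in time there, with `u` continuous on `closure Ω × [0,T]` and `v`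
continuous on `Ω × [0,T]`. If there is a continuous `V : Ω → ℝ` blowing up at `∂Ω`
with `v(·,t) ≥ V` for each `t ∈ [0,T]`, and `v(·,0) ≥ u(·,0)` on `Ω`, then `v ≥ u`
on `Ω × [0,T]`. -/
theorem direct_comparison_principle
    (Ω : Set (ℝ × ℝ)) (hΩopen : IsOpen Ω) (hΩbdd : Bornology.IsBounded Ω)
    (T : ℝ) (hT : 0 < T)
    (u v : ℝ × ℝ → ℝ → ℝ)
    (hu_cont : ContinuousOn (fun q : (ℝ × ℝ) × ℝ => u q.1 q.2)
      (closure Ω ×ˢ Set.Icc 0 T))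
    (hv_cont : ContinuousOn (fun q : (ℝ × ℝ) × ℝ => v q.1 q.2)
      (Ω ×ˢ Set.Icc 0 T))
    (hu_space : ∀ t ∈ Set.Ioo (0:ℝ) T, ContDiffOn ℝ 2 (fun p => u p t) Ω)
    (hv_space : ∀ t ∈ Set.Ioo (0:ℝ) T, ContDiffOn ℝ 2 (fun p => v p t) Ω)
    (hu_pde : ∀ p ∈ Ω, ∀ t ∈ Set.Ioo (0:ℝ) T,
      HasDerivAt (fun τ => u p τ)
        (Real.exp (-2 * u p t) * lap2 (fun q => u q t) p) t)
    (hv_pde : ∀ p ∈ Ω, ∀ t ∈ Set.Ioo (0:ℝ) T,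
      HasDerivAt (fun τ => v p τ)
        (Real.exp (-2 * v p t) * lap2 (fun q => v q t) p) t)
    (V : ℝ × ℝ → ℝ) (hV_cont : ContinuousOn V Ω)
    (hV_blowup : ∀ x ∈ frontier Ω, Filter.Tendsto V (nhdsWithin x Ω) Filter.atTop)
    (hv_ge_V : ∀ t ∈ Set.Icc (0:ℝ) T, ∀ p ∈ Ω, V p ≤ v p t)
    (h_init : ∀ p ∈ Ω, u p 0 ≤ v p 0) :
    ∀ p ∈ Ω, ∀ t ∈ Set.Icc (0:ℝ) T, u p t ≤ v p t := by
  have hMex : ∃ M : ℝ, ∀ p ∈ Ω, ∀ t ∈ Set.Icc (0:ℝ) T, u p t ≤ M := by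
    have hK : IsCompact (closure Ω ×ˢ Set.Icc (0:ℝ) T) :=
      hΩbdd.isCompact_closure.prod isCompact_Icc
    obtain ⟨M, hM⟩ := hK.bddAbove_image hu_cont
    exact ⟨M, fun p hp t ht => hM ⟨(p, t), ⟨subset_closure hp, ht⟩, rfl⟩⟩
  obtain ⟨M, hM⟩ := hMex
  let s : ℝ → ℝ → ℝ := fun ε t => t - ε * (t + t ^ 2 / 2)
  let c : ℝ → ℝ → ℝ := fun ε t => -(1 / 2) * Real.log (1 - ε * (1 + t))
  have hs_mem : ∀ ε > 0, ε * (1 + T) < 1 → ∀ t ∈ Set.Icc 0 T, s ε t ∈ Set.Icc 0 t := by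
    intro ε hε hε1 t ht
    have e1 : ε * (1 + t / 2) ≤ ε * (1 + T) := by
      apply mul_le_mul_of_nonneg_left _ hε.le; linarith [ht.1, ht.2]
    have e2 : 0 ≤ t * (1 - ε * (1 + t / 2)) := mul_nonneg ht.1 (by linarith)
    have e3 : 0 ≤ ε * (t + t ^ 2 / 2) := by have := ht.1; positivity
    exact ⟨by simp only [s]; linarith, by simp only [s]; linarith⟩
  have hs_pos : ∀ ε > 0, ε * (1 + T) < 1 → ∀ t ∈ Set.Ioc 0 T, 0 < s ε t := by
    intro ε hε hε1 t ht
    have e1 : ε * (1 + t / 2) ≤ ε * (1 + T) := by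
      apply mul_le_mul_of_nonneg_left _ hε.le; linarith [ht.1, ht.2]
    have e2 : 0 < t * (1 - ε * (1 + t / 2)) := mul_pos ht.1 (by linarith)
    simp only [s]; linarith
  have harg : ∀ ε > 0, ε * (1 + T) < 1 → ∀ t ∈ Set.Icc 0 T,
      0 < 1 - ε * (1 + t) ∧ 1 - ε * (1 + t) < 1 := by
    intro ε hε hε1 t ht
    have e1 : ε * (1 + t) ≤ ε * (1 + T) := by
      apply mul_le_mul_of_nonneg_left _ hε.le; linarith [ht.2]
    have e2 : 0 < ε * (1 + t) := mul_pos hε (by linarith [ht.1])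
    constructor <;> linarith
  have hc_pos : ∀ ε > 0, ε * (1 + T) < 1 → ∀ t ∈ Set.Icc 0 T, 0 < c ε t := by
    intro ε hε hε1 t ht
    obtain ⟨h1, h2⟩ := harg ε hε hε1 t ht
    have := Real.log_neg h1 h2
    simp only [c]; linarith
  have main : ∀ ε > 0, ε * (1 + T) < 1 → ∀ a, 0 < a → a < T → ∀ p ∈ Ω, ∀ t ∈ Set.Icc 0 a,
      0 < v p (s ε t) + c ε t - u p t := by
    intro ε hε hε1 a ha haT
    have hsub : Set.Icc 0 a ⊆ Set.Icc 0 T := Set.Icc_subset_Icc_right haT.le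
    have hsT : ∀ t ∈ Set.Icc 0 a, s ε t ∈ Set.Icc 0 T := fun t ht =>
      ⟨(hs_mem ε hε hε1 t (hsub ht)).1, (hs_mem ε hε hε1 t (hsub ht)).2.trans (hsub ht).2⟩
    refine dcp_touch Ω hΩopen hΩbdd a (fun p t => v p (s ε t) + c ε t - u p t) ?_ V M hV_blowup
      ?_ ?_ ?_
    · refine ContinuousOn.sub (ContinuousOn.add ?_ ?_) ?_
      · refine hv_cont.comp (f := fun q : (ℝ × ℝ) × ℝ => (q.1, s ε q.2)) ?_ ?_
        · simp only [s]; fun_prop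
        · intro q hq
          exact ⟨hq.1, hsT _ hq.2⟩
      · simp only [c]
        refine continuousOn_const.mul (ContinuousOn.log (by fun_prop) ?_)
        intro q hq
        exact (harg ε hε hε1 _ (hsub hq.2)).1.ne'
      · exact hu_cont.mono (Set.prod_mono subset_closure hsub)
    · intro t ht p hp
      have h1 := hv_ge_V _ (hsT t ht) p hp
      have h2 := hM p hp t (hsub ht)
      have h3 := hc_pos ε hε hε1 t (hsub ht)
      linarith
    · intro p hp
      have h1 := hc_pos ε hε hε1 0 ⟨le_rfl, hT.le⟩
      have h2 := h_init p hp
      have h3 : s ε 0 = 0 := by simp [s]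
      simp only [h3]; linarith
    · intro p hp t ht hzero hnn hpos
      have htI : t ∈ Set.Icc 0 T := ⟨ht.1.le, ht.2.trans haT.le⟩
      have htO : t ∈ Set.Ioo 0 T := ⟨ht.1, ht.2.trans_lt haT⟩
      have hsO : s ε t ∈ Set.Ioo 0 T :=
        ⟨hs_pos ε hε hε1 t ⟨htI.1.lt_of_ne ht.1.ne, htI.2⟩,
          (hs_mem ε hε hε1 t htI).2.trans_lt htO.2⟩
      obtain ⟨hg1, hg2⟩ := harg ε hε hε1 t htI
      have hds : HasDerivAt (s ε) (1 - ε * (1 + t)) t := by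
        have := (hasDerivAt_id t).sub
          ((((hasDerivAt_id t).add (((hasDerivAt_id t).pow 2).div_const 2))).const_mul ε)
        have e : (1 - ε * (1 + ((2 : ℕ) : ℝ) * id t ^ (2 - 1) * 1 / 2)) = 1 - ε * (1 + t) := by
          simp
        rw [e] at this
        exact this
      have hdc : HasDerivAt (c ε) (ε / (2 * (1 - ε * (1 + t)))) t := by
        have h1 : HasDerivAt (fun r : ℝ => 1 - ε * (1 + r)) (-(ε * 1)) t :=
          (((hasDerivAt_id t).const_add 1).const_mul ε).const_sub 1
        have := (h1.log hg1.ne').const_mul (-(1 / 2))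
        have e : -(1 / 2) * (-(ε * 1) / (1 - ε * (1 + t))) = ε / (2 * (1 - ε * (1 + t))) := by
          field_simp
        rw [e] at this
        exact this
      have hdv := (hv_pde p hp _ hsO).comp t hds
      have hdw := (hdv.add hdc).sub (hu_pde p hp t htO)
      have hd := dcp_deriv_nonpos _ t _ ht.1 hdw hzero hpos
      have hlap : lap2 (fun q => u q t) p ≤ lap2 (fun q => v q (s ε t)) p := by
        apply dcp_lap Ω hΩopen _ _ p hp (hv_space _ hsO) (hu_space t htO)
        intro q hq
        have := hnn q hq
        linarith
      have hexp : Real.exp (-2 * v p (s ε t)) * (1 - ε * (1 + t)) = Real.exp (-2 * u p t) := by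
        have e1 : u p t = v p (s ε t) + c ε t := by linarith
        have e2 : -2 * u p t = -2 * v p (s ε t) + Real.log (1 - ε * (1 + t)) := by
          rw [e1]; simp only [c]; ring
        rw [e2, Real.exp_add, Real.exp_log hg1]
      have hcp : 0 < ε / (2 * (1 - ε * (1 + t))) := by positivity
      have h5 : Real.exp (-2 * v p (s ε t)) * lap2 (fun q => v q (s ε t)) p * (1 - ε * (1 + t))
          = Real.exp (-2 * u p t) * lap2 (fun q => v q (s ε t)) p := by
        rw [← hexp]; ring
      rw [h5] at hd
      have h6 := mul_le_mul_of_nonneg_left hlap (Real.exp_pos (-2 * u p t)).le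
      linarith
  have hlt : ∀ p ∈ Ω, ∀ t ∈ Set.Ico 0 T, u p t ≤ v p t := by
    intro p hp t ht
    have htI : t ∈ Set.Icc 0 T := ⟨ht.1, ht.2.le⟩
    have hsm : ∀ᶠ ε in nhdsWithin (0:ℝ) (Set.Ioi 0), 0 < ε ∧ ε * (1 + T) < 1 := by
      have h1 : ∀ᶠ ε in nhds (0:ℝ), ε * (1 + T) < 1 :=
        ContinuousAt.eventually_lt (by fun_prop) continuousAt_const (by simp)
      filter_upwards [self_mem_nhdsWithin, h1.filter_mono nhdsWithin_le_nhds] with ε a b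
      exact ⟨a, b⟩
    have ls : Filter.Tendsto (fun ε => (p, s ε t)) (nhdsWithin 0 (Set.Ioi 0))
        (nhdsWithin (p, t) (Ω ×ˢ Set.Icc 0 T)) := by
      refine tendsto_nhdsWithin_iff.2 ⟨?_, ?_⟩
      · have : Filter.Tendsto (fun ε => (p, s ε t)) (nhds 0) (nhds (p, s 0 t)) :=
          Continuous.tendsto (by simp only [s]; fun_prop) 0
        have h0 : s 0 t = t := by simp [s]
        rw [h0] at this
        exact this.mono_left nhdsWithin_le_nhds
      · filter_upwards [hsm] with ε hε
        have := hs_mem ε hε.1 hε.2 t htI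
        exact ⟨hp, this.1, this.2.trans htI.2⟩
    have lv := (hv_cont (p, t) ⟨hp, htI⟩).tendsto.comp ls
    have lc : Filter.Tendsto (fun ε => c ε t) (nhdsWithin 0 (Set.Ioi 0)) (nhds 0) := by
      have h1 : ContinuousAt (fun ε => c ε t) 0 := by
        simp only [c]
        exact continuousAt_const.mul (ContinuousAt.log (by fun_prop) (by simp))
      have h2 : c 0 t = 0 := by simp [c]
      have h3 := h1.tendsto
      rw [h2] at h3
      exact h3.mono_left nhdsWithin_le_nhds
    have l := lv.add lc
    rw [add_zero] at l
    refine ge_of_tendsto l ?_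
    filter_upwards [hsm] with ε hε
    have := main ε hε.1 hε.2 ((t + T) / 2) (by linarith [ht.1]) (by linarith [ht.2]) p hp t
      ⟨ht.1, by linarith [ht.2]⟩
    simp only [Function.comp]
    linarith
  intro p hp t ht
  rcases ht.2.lt_or_eq with h | h
  · exact hlt p hp t ⟨ht.1, h⟩
  · subst h
    have hne : (nhdsWithin t (Set.Ico 0 t)).NeBot := by
      rw [nhdsWithin_Ico_eq_nhdsLT hT]; infer_instance
    have l : ∀ S : Set (ℝ × ℝ), p ∈ S → Filter.Tendsto (fun r => (p, r))
        (nhdsWithin t (Set.Ico 0 t)) (nhdsWithin (p, t) (S ×ˢ Set.Icc 0 t)) := by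
      intro S hS
      refine tendsto_nhdsWithin_iff.2 ⟨?_, ?_⟩
      · exact (Continuous.tendsto (by fun_prop) t).mono_left nhdsWithin_le_nhds
      · filter_upwards [self_mem_nhdsWithin] with r hr
        exact ⟨hS, hr.1, hr.2.le⟩
    have lu := (hu_cont (p, t) ⟨subset_closure hp, ht⟩).tendsto.comp (l _ (subset_closure hp))
    have lv := (hv_cont (p, t) ⟨hp, ht⟩).tendsto.comp (l _ hp)
    refine le_of_tendsto_of_tendsto lu lv ?_
    filter_upwards [self_mem_nhdsWithin] with r hr
    exact hlt p hp r hr
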